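/- Let V be a 2-TVASS with state set Q and let q ∈ Q. There exists a finite set Λ of linear path schemes, each of which is either a single path from q to q or of the form α β* where α is a path from q to q and β is a cycle on q, such that for all x, y ∈ ℕ with x < y: if q(0, x) →* q(0, y), then q(0, x) →^L q(0, y) for some L ∈ Λ. -/

import Mathlib

namespace TVASSpaper

/-- Actions of a `d`-TVASS: `some a` is an addition of the vector `a ∈ ℤ^d`,
    `none` is the zero-test action `tst` (on the first counter). -/
abbrev Act (d : ℕ) := Option (Fin d → ℤ)

/-- Transitions. -/
abbrev Trans (d : ℕ) (Q : Type) := Q × Act d × Q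

/-- Configurations: a state together with a vector of `d` counters. -/
abbrev Config (d : ℕ) (Q : Type) := Q × (Fin d → ℕ)

/-- A `d`-TVASS: a finite set `acts` of actions and a finite set of transitions
    `trans ⊆ Q × acts × Q`. The state set `Q` is a (finite, nonempty) type. -/
structure TVASS (d : ℕ) (Q : Type) where
  acts : Finset (Act d)
  trans : Finset (Trans d Q)
  mem_acts : ∀ t ∈ trans, t.2.1 ∈ acts

variable {d : ℕ} {Q : Type}

/-- The step induced by a single transition: an addition transition `(p, a, q)`
    induces `p(x) → q(x + a)` whenever `x + a ∈ ℕ^d`; a zero-test transition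
    `(p, tst, q)` induces `p(x) → q(x)` whenever the first counter is `0`. -/
def StepBy [NeZero d] (t : Trans d Q) (c c' : Config d Q) : Prop :=
  t.1 = c.1 ∧ t.2.2 = c'.1 ∧
    match t.2.1 with
    | some a => ∀ i, (c'.2 i : ℤ) = (c.2 i : ℤ) + a i
    | none => c.2 0 = 0 ∧ c'.2 = c.2

/-- `Run V c π c'` : there is a run from `c` to `c'` taking the steps of the
    word of transitions `π` in order. -/
inductive Run [NeZero d] (V : TVASS d Q) :
    Config d Q → List (Trans d Q) → Config d Q → Prop
  | nil (c : Config d Q) : Run V c [] c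
  | cons {t : Trans d Q} {c c' c'' : Config d Q} {π : List (Trans d Q)} :
      t ∈ V.trans → StepBy t c c' → Run V c' π c'' → Run V c (t :: π) c''

/-- One step of the TVASS. -/
def Step [NeZero d] (V : TVASS d Q) (c c' : Config d Q) : Prop :=
  ∃ t ∈ V.trans, StepBy t c c'

/-- Reachability `c →* c'`. -/
def Reach [NeZero d] (V : TVASS d Q) (c c' : Config d Q) : Prop :=
  ∃ π, Run V c π c'

/-- `IsPathFrom V p π q` : `π` is a path (word of transitions of `V` with
    matching endpoints) from state `p` to state `q`. -/
inductive IsPathFrom (V : TVASS d Q) : Q → List (Trans d Q) → Q → Prop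
  | nil (p : Q) : IsPathFrom V p [] p
  | cons {t : Trans d Q} {π : List (Trans d Q)} {q : Q} :
      t ∈ V.trans → IsPathFrom V t.2.2 π q → IsPathFrom V t.1 (t :: π) q

/-- `n`-fold concatenation of a word. -/
def pw {α : Type*} (l : List α) (n : ℕ) : List α := (List.replicate n l).flatten

/-- A linear path scheme `α₀ β₁* α₁ ⋯ β_k* α_k`, given by the head path `α₀`
    and the list of pairs `(β₁, α₁), …, (β_k, α_k)`. -/
structure LPS (d : ℕ) (Q : Type) where
  head : List (Trans d Q)
  rest : List (List (Trans d Q) × List (Trans d Q))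

/-- Length `|L|` of a linear path scheme. -/
def LPS.len (L : LPS d Q) : ℕ :=
  L.head.length + (L.rest.map fun p => p.1.length + p.2.length).sum

/-- Number of stars `|L|_*` of a linear path scheme. -/
def LPS.stars (L : LPS d Q) : ℕ := L.rest.length

def wordRest : List (List (Trans d Q) × List (Trans d Q)) → List ℕ → List (Trans d Q)
  | [], _ => []
  | p :: rest, ns => pw p.1 (ns.headD 0) ++ p.2 ++ wordRest rest ns.tail

/-- The word `α₀ β₁^{n₁} α₁ ⋯ β_k^{n_k} α_k` of `L` for exponents `ns`. -/
def LPS.word (L : LPS d Q) (ns : List ℕ) : List (Trans d Q) :=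
  L.head ++ wordRest L.rest ns

/-- Well-formedness of the tail of a linear path scheme starting in state `s`:
    the `βᵢ` are cycles and the `αᵢ` are paths, with matching endpoints. -/
inductive ChainLPS (V : TVASS d Q) :
    Q → List (List (Trans d Q) × List (Trans d Q)) → Q → Prop
  | nil (q : Q) : ChainLPS V q [] q
  | cons {s s' q : Q} {β α : List (Trans d Q)}
      {rest : List (List (Trans d Q) × List (Trans d Q))} :
      IsPathFrom V s β s → IsPathFrom V s α s' → ChainLPS V s' rest q →
      ChainLPS V s ((β, α) :: rest) q

/-- `L` is a genuine linear path scheme from `p` to `q` in `V`. -/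
def IsLPS (V : TVASS d Q) (p : Q) (L : LPS d Q) (q : Q) : Prop :=
  ∃ s, IsPathFrom V p L.head s ∧ ChainLPS V s L.rest q

/-- `c →^L c'` : reachability along the linear path scheme `L`. -/
def ReachLPS [NeZero d] (V : TVASS d Q) (L : LPS d Q) (c c' : Config d Q) : Prop :=
  ∃ ns, Run V c (L.word ns) c'

/-- `‖x⃗‖`: maximum component of a vector of naturals. -/
def vnorm {d : ℕ} (v : Fin d → ℕ) : ℕ := Finset.univ.sup v

/-- Maximum absolute value of a component of an integer vector. -/
def vnormZ {d : ℕ} (v : Fin d → ℤ) : ℕ := Finset.univ.sup fun i => (v i).natAbs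

/-- `‖Σ‖`: maximum absolute value of a component of a vector in `Σ ∖ {tst}`
    (0 if `Σ ⊆ {tst}`). -/
def TVASS.actNorm (V : TVASS d Q) : ℕ :=
  V.acts.sup fun a => a.elim 0 vnormZ

/-- Displacement of a word of transitions (zero-tests contribute `0`). -/
def disp (π : List (Trans d Q)) : Fin d → ℤ :=
  fun i => (π.map fun t => (t.2.1.elim 0 id : Fin d → ℤ) i).sum

/-- `m_π(i)`: max over prefixes `α` of `π` (including the empty prefix) of `-Δ(α)(i)`. -/
def mpre (π : List (Trans d Q)) (i : Fin d) : ℤ :=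
  (π.inits.map fun α => -(disp α i)).foldr max 0

/-- `m_π̄(i)`: max over suffixes `σ` of `π` (including the empty suffix) of `Δ(σ)(i)`. -/
def msuf (π : List (Trans d Q)) (i : Fin d) : ℤ :=
  (π.tails.map fun σ => disp σ i).foldr max 0

/-- `π` contains no zero-test transition. -/
def noTst (π : List (Trans d Q)) : Prop := ∀ t ∈ π, t.2.1 ≠ none

/-- `x⃗ ≥₁ m⃗` : `x⃗(1) = m⃗(1)` and `x⃗(i) ≥ m⃗(i)` for all other `i`. -/
def ge1 [NeZero d] (x : Fin d → ℕ) (m : Fin d → ℤ) : Prop :=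
  (x 0 : ℤ) = m 0 ∧ ∀ i : Fin d, i ≠ 0 → m i ≤ (x i : ℤ)

/-- A path from `p` to `q` is feasible if some run takes it. -/
def Feasible [NeZero d] (V : TVASS d Q) (p : Q) (π : List (Trans d Q)) (q : Q) : Prop :=
  ∃ x y, Run V (p, x) π (q, y)

/-- `c →^{A* ∪ T} c'` : there is a run from `c` to `c'` whose path either
    contains no zero-test transition, or is a single zero-test transition. -/
def ReachAT [NeZero d] (V : TVASS d Q) (c c' : Config d Q) : Prop :=
  ∃ π, Run V c π c' ∧ (noTst π ∨ ∃ t : Trans d Q, π = [t] ∧ t.2.1 = none)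

/-- `p ⇝ q` for a 2-TVASS: `p(0, x) →* q(0, y)` for some `x, y ∈ ℕ`. -/
def Leads (V : TVASS 2 Q) (p q : Q) : Prop :=
  ∃ x y : ℕ, Reach V (p, ![0, x]) (q, ![0, y])

/-- The linear path scheme `L` is bounded from the configuration `c`: the set of
    configurations reachable from `c` along a prefix of a path in `L` is finite. -/
def BoundedLPS [NeZero d] (V : TVASS d Q) (L : LPS d Q) (c : Config d Q) : Prop :=
  {c' : Config d Q | ∃ ns ρ, ρ <+: L.word ns ∧ Run V c ρ c'}.Finite


section FlatteningIncreasingLoops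

variable [NeZero d] {V : TVASS d Q}

theorem Run.isPathFrom {c c' : Config d Q} {π : List (Trans d Q)} (h : Run V c π c') :
    IsPathFrom V c.1 π c'.1 := by
  induction h with
  | nil c => exact .nil _
  | cons ht hs _ ih =>
    rw [← hs.1]
    exact .cons ht (by rw [hs.2.1]; exact ih)

theorem Run.append {c c' c'' : Config d Q} {π ρ : List (Trans d Q)} (h : Run V c π c')
    (h' : Run V c' ρ c'') : Run V c (π ++ ρ) c'' := by
  induction h with
  | nil c => exact h'
  | cons ht hs _ ih => exact .cons ht hs (ih h')

/-- Runs are preserved when counters other than the tested one are increased. -/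
theorem Run.add_right {c c' : Config d Q} {π : List (Trans d Q)} (h : Run V c π c')
    {e : Fin d → ℕ} (he : e 0 = 0) : Run V (c.1, c.2 + e) π (c'.1, c'.2 + e) := by
  induction h with
  | nil c => exact .nil _
  | @cons t c c' c'' π ht hs _ ih =>
    refine .cons (c' := (c'.1, c'.2 + e)) ht ⟨hs.1, hs.2.1, ?_⟩ ih
    have hstep := hs.2.2
    split at hstep
    · intro i
      have := hstep i
      simp only [Pi.add_apply]
      push_cast
      linarith
    · exact ⟨by simp [hstep.1, he], by rw [hstep.2]⟩

end FlatteningIncreasingLoops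

theorem Run.shift {V : TVASS 2 Q} {p q : Q} {π : List (Trans 2 Q)} {x y : ℕ}
    (h : Run V (p, ![0, x]) π (q, ![0, y])) (k : ℕ) :
    Run V (p, ![0, x + k]) π (q, ![0, y + k]) := by
  simpa using h.add_right (e := ![0, k]) rfl

theorem Run.iterate {V : TVASS 2 Q} {q : Q} {β : List (Trans 2 Q)} {m b : ℕ}
    (h : Run V (q, ![0, m]) β (q, ![0, m + b])) (n : ℕ) {x : ℕ} (hx : m ≤ x) :
    Run V (q, ![0, x]) (pw β n) (q, ![0, x + n * b]) := by
  induction n generalizing x with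
  | zero => simpa [pw] using Run.nil (V := V) (q, ![0, x])
  | succ n ih =>
    have hfirst : Run V (q, ![0, x]) β (q, ![0, x + b]) := by
      convert h.shift (x - m) using 4 <;> omega
    have hrest := ih (x := x + b) (by omega)
    have hword : pw β (n + 1) = β ++ pw β n := by
      simp [pw, List.replicate_succ]
    rw [hword, show x + (n + 1) * b = x + b + n * b by ring]
    exact hfirst.append hrest

/-- Dickson's lemma: every set in a well quasi-ordered, well-founded partial order
    has a finite basis. -/
theorem exists_finset_basis {α : Type*} [PartialOrder α] [WellQuasiOrderedLE α]
    (S : Set α) :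
    ∃ F : Finset α, (∀ f ∈ F, f ∈ S) ∧ ∀ s ∈ S, ∃ f ∈ F, f ≤ s := by
  have hfin : {a | Minimal (· ∈ S) a}.Finite :=
    WellQuasiOrderedLE.finite_of_isAntichain (setOfPred_minimal_antichain (· ∈ S))
  refine ⟨hfin.toFinset, fun f hf => ?_, fun s hs => ?_⟩
  · exact (hfin.mem_toFinset.1 hf).prop
  · obtain ⟨f, hle, hf⟩ := exists_minimal_le_of_wellFoundedLT (· ∈ S) s hs
    exact ⟨f, hfin.mem_toFinset.2 hf, hle⟩

/-- Lemma: increasing vertical loops are flattenable.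
    Each member of `Λ` is a pair `(α, o)` where `α` is a path from `q` to `q`
    and `o` is either `none` (the LPS is the single path `α`) or `some β`
    with `β` a cycle on `q` (the LPS is `α β*`). -/
theorem increasing_vloop_flattenable (Q : Type) [Fintype Q] [Nonempty Q]
    (V : TVASS 2 Q) (q : Q) :
    ∃ Λ : List (List (Trans 2 Q) × Option (List (Trans 2 Q))),
      (∀ l ∈ Λ, IsPathFrom V q l.1 q ∧ ∀ β ∈ l.2, IsPathFrom V q β q) ∧
      ∀ x y : ℕ, x < y →
        Reach V (q, ![0, x]) (q, ![0, y]) →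
        ∃ l ∈ Λ, ∃ n : ℕ,
          Run V (q, ![0, x]) (l.1 ++ l.2.elim [] (fun β => pw β n))
            (q, ![0, y]) := by
  classical
  by_cases hex : ∃ x y, x < y ∧ Reach V (q, ![0, x]) (q, ![0, y])
  swap
  · exact ⟨[], by simp, fun x y hxy h => absurd ⟨x, y, hxy, h⟩ hex⟩
  -- The loop `β` starts from the least counter value allowing an increasing loop,
  -- so it can be taken at the end of every increasing loop.
  obtain ⟨y₀, hlt, β, hβ⟩ := Nat.find_spec hex
  have hmin {x y : ℕ} (hxy : x < y) (h : Reach V (q, ![0, x]) (q, ![0, y])) :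
      Nat.find hex ≤ x := Nat.find_min' hex ⟨y, hxy, h⟩
  generalize Nat.find hex = m at hlt hβ hmin
  obtain ⟨b, rfl⟩ := Nat.exists_eq_add_of_lt hlt
  let c := b + 1
  have hc : 0 < c := Nat.succ_pos b
  choose F hF hbasis using fun r => exists_finset_basis
    {p : ℕ × ℕ | p.1 < p.1 + (r + p.2 * c) ∧
      Reach V (q, ![0, p.1]) (q, ![0, p.1 + (r + p.2 * c)])}
  choose! w hw using fun (x y : ℕ) (h : Reach V (q, ![0, x]) (q, ![0, y])) => h
  refine ⟨(List.range c).flatMap fun r => (F r).toList.map fun p =>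
    (w p.1 (p.1 + (r + p.2 * c)), some β), ?_, fun x y hxy hreach => ?_⟩
  · simp only [List.mem_flatMap, List.mem_map, Finset.mem_toList]
    rintro _ ⟨r, -, p, hp, rfl⟩
    refine ⟨(hw _ _ (hF r p hp).2).isPathFrom, fun γ hγ => ?_⟩
    obtain rfl := Option.some.inj hγ
    exact hβ.isPathFrom
  · let r := (y - x) % c
    let k := (y - x) / c
    have hdiv : r + k * c = y - x := Nat.mod_add_div' _ _
    have hy : x + (r + k * c) = y := by omega
    obtain ⟨⟨x', k'⟩, hmem, hx', hk'⟩ :=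
      hbasis r (x, k) ⟨by simpa only [hy] using hxy, by simpa only [hy] using hreach⟩
    obtain ⟨hlt', hreach'⟩ := hF r _ hmem
    dsimp only at hx' hk' hlt' hreach'
    refine ⟨(w x' (x' + (r + k' * c)), some β), ?_, k - k', ?_⟩
    · simp only [List.mem_flatMap, List.mem_map, Finset.mem_toList, List.mem_range]
      exact ⟨r, Nat.mod_lt _ hc, _, hmem, rfl⟩
    · have hm := hmin hlt' hreach'
      have hα := (hw _ _ hreach').shift (x - x')
      rw [Nat.add_sub_cancel' hx'] at hα
      have hloop := hβ.iterate (b := c) (k - k') (x := x' + (r + k' * c) + (x - x')) (by omega)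
      have hmul : k' * c + (k - k') * c = k * c := by
        rw [← Nat.add_mul, Nat.add_sub_cancel' hk']
      rw [show y = x' + (r + k' * c) + (x - x') + (k - k') * c by omega]
      exact hα.append hloop

end TVASSpaper
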